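/- Let $k$ be an algebraically closed field of characteristic zero, let $s \geq 2$, $t \geq 1$ and $u \geq 0$ be integers, set $v = (s-1)t + (u+1)s$, let $\omega \in k$ be a primitive $v$-th root of unity, and let $\psi$ be the $k$-algebra automorphism of $k[x,y]$ with $\psi(x) = \omega x$ and $\psi(y) = \omega^{u+t+1} y$. Let $d = \partial_x + x^u(x^t + y^s)\partial_y$. If $d$ is not a simple derivation of $k[x,y]$, then there exist a polynomial $g \in k[x,y]$, written $g = \sum_{i=0}^{n} a_i x^i$ with $a_i \in k[y]$, and an element $a \in k$, such that: $a_n = 1$; $n > 0$ is a multiple of both $t$ and $v$; $d(g) = a\, x^u y^{s-1} g$; $\psi(g) = g$; and $a_{n-t+i} = 0$ for $1 \leq i \leq t-1$. -/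

import Mathlib

/-
The proof shows that the derivation `∂x + x^u (x^t + y^s) ∂y` is in fact always simple
(`s ≥ 2`, `t ≥ 1`), so the hypothesis `hns` is contradictory.
-/
open MvPolynomial

/-- A `k`-derivation `d` of `k[x,y]` is *simple* if the only `d`-differential ideals
(ideals `I` with `d(I) ⊆ I`) are `(0)` and the whole ring. Here `k[x,y]` is modelled as
`MvPolynomial (Fin 2) k`, with `x = X 0` and `y = X 1`. -/
def IsSimpleDerivation {k : Type*} [CommRing k]
    (d : Derivation k (MvPolynomial (Fin 2) k) (MvPolynomial (Fin 2) k)) : Prop :=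
  ∀ I : Ideal (MvPolynomial (Fin 2) k), (∀ f ∈ I, d f ∈ I) → I = ⊥ ∨ I = ⊤



theorem comb_contra {k : Type*} [Field k] [CharZero k] (s t u n : ℤ) (hs : 2 ≤ s) (ht : 1 ≤ t)
    (hu : 0 ≤ u) (hn : 0 < n) (a : k) (c : ℤ → ℤ → k)
    (hneg1 : ∀ i j, i < 0 → c i j = 0) (hneg2 : ∀ i j, j < 0 → c i j = 0)
    (H : ∀ I J : ℤ, ((I : k) + 1) * c (I + 1) J + ((J : k) + 1) * c (I - u - t) (J + 1)
      + ((J : k) - s + 1) * c (I - u) (J - s + 1) = a * c (I - u) (J - s + 1))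
    (htop : ∀ i j, n < i → c i j = 0) (hne : ∃ j, c n j ≠ 0) : False := by
  -- the top coefficient is constant
  have h1 : ∀ j, j ≠ 0 → c n j = 0 := by
    intro j hj
    have h := H (n + u + t) (j - 1)
    rw [htop (n + u + t + 1) _ (by linarith), htop (n + u + t - u) _ (by linarith),
      show n + u + t - u - t = n by ring, show j - 1 + 1 = j by ring] at h
    push_cast at h
    simp only [mul_zero, zero_add, add_zero, sub_add_cancel] at h
    have : (j : k) ≠ 0 := by exact_mod_cast hj
    simpa [this] using h
  have hg0 : c n 0 ≠ 0 := by
    obtain ⟨j, hj⟩ := hne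
    by_cases h : j = 0
    · rwa [h] at hj
    · exact absurd (h1 j h) hj
  -- weighted degree bound
  have hwt : ∀ (m : ℕ) (i j : ℤ), n - m < i → n * s < i * s + j * t → c i j = 0 := by
    intro m
    induction m with
    | zero =>
      intro i j hi _
      exact htop i j (by simpa using hi)
    | succ m ih =>
      intro i j hi hw
      push_cast at hi
      by_cases hj : j = 0
      · subst hj
        apply htop
        nlinarith
      have h := H (i + u + t) (j - 1)
      rw [ih (i + u + t + 1) _ (by linarith) (by nlinarith),
        show j - 1 - s + 1 = j - s by ring, show i + u + t - u = i + t by ring,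
        ih (i + t) (j - s) (by linarith) (by nlinarith),
        show i + t - t = i by ring, show j - 1 + 1 = j by ring] at h
      push_cast at h
      simp only [mul_zero, zero_add, add_zero, sub_add_cancel] at h
      have : (j : k) ≠ 0 := by exact_mod_cast hj
      simpa [this] using h
  have hwt' : ∀ (i j : ℤ), n * s < i * s + j * t → c i j = 0 := by
    intro i j h
    exact hwt ((n - i).toNat + 1) i j (by have := Int.self_le_toNat (n - i); push_cast; linarith) h
  have hs0 : (s : k) ≠ 0 := by exact_mod_cast (by linarith : s ≠ 0)
  -- first diagonal
  obtain ⟨g, hg⟩ : ∃ g : ℕ → k, ∀ q : ℕ, g q = c (n - t * q) (s * q) := ⟨_, fun _ => rfl⟩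
  have hgrec : ∀ q : ℕ, (s * (q + 1) : k) * g (q + 1) = (a - s * q) * g q := by
    intro q
    have h := H (n - t * q + u) (s * q + s - 1)
    rw [hwt' (n - t * q + u + 1) _ (by nlinarith),
      show n - t * q + u - u = n - t * q by ring, show s * q + s - 1 - s + 1 = s * (q:ℤ) by ring,
      show n - t * q - t = n - t * ((q + 1 : ℕ) : ℤ) by push_cast; ring,
      show s * q + s - 1 + 1 = s * ((q + 1 : ℕ) : ℤ) by push_cast; ring, ← hg, ← hg] at h
    push_cast at h
    linear_combination h
  have hgz : ∃ q, g q = 0 := by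
    refine ⟨n.toNat + 1, ?_⟩
    rw [hg]
    apply hneg1
    have := Int.self_le_toNat n
    push_cast
    nlinarith
  have hg00 : g 0 = c n 0 := by rw [hg]; simp
  obtain ⟨e, he1, he2⟩ : ∃ e, g e ≠ 0 ∧ g (e + 1) = 0 := by
    classical
    have hpos : Nat.find hgz ≠ 0 := by
      intro h
      have := Nat.find_spec hgz
      rw [h, hg00] at this
      exact hg0 this
    obtain ⟨e, he⟩ := Nat.exists_eq_succ_of_ne_zero hpos
    refine ⟨e, Nat.find_min hgz (by omega), ?_⟩
    have := Nat.find_spec hgz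
    rwa [he] at this
  have ha : a = s * e := by
    have h := hgrec e
    rw [he2, mul_zero] at h
    rcases mul_eq_zero.mp h.symm with h | h
    · linear_combination h
    · exact absurd h he1
  have hne' : t * e ≤ n := by
    by_contra hcon
    exact he1 (by rw [hg]; exact hneg1 _ _ (by linarith))
  have hgc : ∀ q, g q = c n 0 * (e.choose q : k) := by
    intro q
    induction q with
    | zero => simp [hg00]
    | succ q ih =>
      have h := hgrec q
      have hq : ((q : k) + 1) ≠ 0 := by exact_mod_cast Nat.succ_ne_zero q
      rw [ih, ha] at h
      have hc : (e.choose (q + 1) : k) * (q + 1) = e.choose q * (e - q) := by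
        by_cases hqe : q ≤ e
        · have := Nat.choose_succ_right_eq e q
          rw [← Nat.cast_sub hqe]
          exact_mod_cast this
        · rw [Nat.choose_eq_zero_of_lt (by omega), Nat.choose_eq_zero_of_lt (by omega)]
          simp
      apply mul_left_cancel₀ (mul_ne_zero hs0 hq)
      linear_combination h - s * c n 0 * hc
  -- second diagonal
  obtain ⟨h, hh⟩ : ∃ h : ℕ → k, ∀ q : ℕ, h q = c (n - (u + 1) - t * (q + 1)) (s * q + 1) :=
    ⟨_, fun _ => rfl⟩
  have hh0 : h 0 = - n * c n 0 := by
    have h' := H (n - 1) 0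
    rw [hneg2 _ (0 - s + 1) (by linarith)] at h'
    rw [hh]
    rw [show n - 1 + 1 = n by ring, show n - 1 - u - t = n - (u + 1) - t * ((0 : ℕ) + 1) by simp; ring,
      show (0 : ℤ) + 1 = s * ((0 : ℕ) : ℤ) + 1 by simp] at h'
    push_cast at h' ⊢
    linear_combination h'
  have hhrec : ∀ q : ℕ, (s * (q + 1) + 1 : k) * h (q + 1) =
      (s * (e - q) - 1) * h q - (n - t * (q + 1)) * (e.choose (q + 1)) * c n 0 := by
    intro q
    have h' := H (n - t * (q + 1) - 1) (s * (q + 1))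
    rw [show n - t * (q + 1) - 1 + 1 = n - t * ((q + 1 : ℕ) : ℤ) by push_cast; ring,
      show s * ((q : ℤ) + 1) = s * ((q + 1 : ℕ) : ℤ) by push_cast; ring, ← hg, hgc,
      show n - t * (q + 1) - 1 - u - t = n - (u + 1) - t * (((q + 1 : ℕ) : ℤ) + 1) by push_cast; ring,
      ← hh,
      show n - t * (q + 1) - 1 - u = n - (u + 1) - t * ((q : ℤ) + 1) by ring,
      show s * ((q + 1 : ℕ) : ℤ) - s + 1 = s * q + 1 by push_cast; ring, ← hh, ha] at h'
    push_cast at h'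
    linear_combination h'
  have hneg : ∀ q : ℕ, q ≤ e → ∃ ρ : ℚ, ρ < 0 ∧ h q = c n 0 * (ρ : k) := by
    intro q
    induction q with
    | zero =>
      intro _
      refine ⟨-n, by simpa using hn, ?_⟩
      rw [hh0]; push_cast; ring
    | succ q ih =>
      intro hq
      obtain ⟨ρ, hρ, hρ'⟩ := ih (by omega)
      have hr := hhrec q
      have hsq : (0 : ℚ) < s * (q + 1) + 1 := by
        have : (0 : ℚ) < s := by exact_mod_cast (by linarith : 0 < s)
        positivity
      refine ⟨((s * (e - q) - 1) * ρ - (n - t * (q + 1)) * (e.choose (q + 1))) / (s * (q + 1) + 1),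
        ?_, ?_⟩
      · apply div_neg_of_neg_of_pos _ hsq
        have h1 : (0 : ℚ) < s * (e - q) - 1 := by
          have h2 : (2 : ℚ) ≤ s := by exact_mod_cast hs
          have h3 : (1 : ℚ) ≤ e - q := by
            have : ((q + 1 : ℕ) : ℚ) ≤ e := by exact_mod_cast hq
            push_cast at this
            linarith
          nlinarith
        have h4 : (0 : ℚ) ≤ n - t * (q + 1) := by
          have h5 : t * (q + 1) ≤ n := by
            have : ((q + 1 : ℕ) : ℤ) ≤ e := by exact_mod_cast hq
            push_cast at this
            nlinarith
          have : (t * (q + 1) : ℚ) ≤ n := by exact_mod_cast h5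
          linarith
        have h6 : (0 : ℚ) ≤ (n - t * (q + 1)) * (e.choose (q + 1)) := by positivity
        nlinarith
      · have hsk : (s * (q + 1) + 1 : k) ≠ 0 := by
          have : (((s * (q + 1) + 1 : ℚ)) : k) ≠ 0 := by exact_mod_cast hsq.ne'
          push_cast at this
          exact this
        push_cast
        field_simp
        rw [hρ'] at hr
        linear_combination hr
  have hnz : ∀ m : ℕ, h (e + m) ≠ 0 := by
    intro m
    induction m with
    | zero =>
      obtain ⟨ρ, hρ, hρ'⟩ := hneg e le_rfl
      rw [add_zero, hρ']
      exact mul_ne_zero hg0 (by exact_mod_cast hρ.ne)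
    | succ m ih =>
      intro h0
      have hr := hhrec (e + m)
      rw [← add_assoc] at h0
      rw [h0, Nat.choose_eq_zero_of_lt (by omega)] at hr
      push_cast at hr
      have : ((-(s * m + 1) : ℤ) : k) * h (e + m) = 0 := by
        push_cast
        linear_combination -hr
      rcases mul_eq_zero.mp this with h' | h'
      · have : -(s * (m : ℤ) + 1) = 0 := by exact_mod_cast h'
        nlinarith
      · exact ih h'
  apply hnz n.toNat
  rw [hh]
  apply hneg1
  have := Int.self_le_toNat n
  push_cast
  nlinarith

/-- exponent vector -/
noncomputable def expo (i j : ℕ) : Fin 2 →₀ ℕ := Finsupp.single 0 i + Finsupp.single 1 j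

theorem expo_zero (i j : ℕ) : expo i j 0 = i := by simp [expo]
theorem expo_one (i j : ℕ) : expo i j 1 = j := by simp [expo]
theorem expo_eta (m : Fin 2 →₀ ℕ) : expo (m 0) (m 1) = m := by
  ext i; fin_cases i
  · exact expo_zero _ _
  · exact expo_one _ _

/-- integer-indexed coefficients -/
noncomputable def cc {k : Type*} [Field k] (p : MvPolynomial (Fin 2) k) (i j : ℤ) : k :=
  if 0 ≤ i ∧ 0 ≤ j then coeff (expo i.toNat j.toNat) p else 0

section
variable {k : Type*} [Field k]

theorem cc_nat (p : MvPolynomial (Fin 2) k) (i j : ℕ) : cc p i j = coeff (expo i j) p := by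
  simp [cc]

theorem cc_neg (p : MvPolynomial (Fin 2) k) (i j : ℤ) (h : i < 0 ∨ j < 0) : cc p i j = 0 := by
  rw [cc, if_neg (by omega)]

theorem cc_add (p q : MvPolynomial (Fin 2) k) (i j : ℤ) : cc (p + q) i j = cc p i j + cc q i j := by
  unfold cc; split_ifs <;> simp

theorem cc_C_mul (a : k) (p : MvPolynomial (Fin 2) k) (i j : ℤ) :
    cc (C a * p) i j = a * cc p i j := by
  unfold cc; split_ifs <;> simp

theorem cc_X0 (p : MvPolynomial (Fin 2) k) (i j : ℤ) : cc (X 0 * p) i j = cc p (i - 1) j := by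
  by_cases hj : 0 ≤ j
  swap
  · rw [cc_neg _ _ _ (by omega), cc_neg _ _ _ (by omega)]
  by_cases hi : 0 ≤ i
  swap
  · rw [cc_neg _ _ _ (by omega), cc_neg _ _ _ (by omega)]
  lift i to ℕ using hi
  lift j to ℕ using hj
  rw [cc_nat, coeff_X_mul']
  cases i with
  | zero => rw [cc_neg _ _ _ (by simp)]; simp [expo]
  | succ i =>
    rw [show ((i + 1 : ℕ) : ℤ) - 1 = (i : ℤ) by push_cast; ring, cc_nat, if_pos]
    · congr 1
      ext l; fin_cases l <;> simp [expo]
    · simp [expo]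

theorem cc_X1 (p : MvPolynomial (Fin 2) k) (i j : ℤ) : cc (X 1 * p) i j = cc p i (j - 1) := by
  by_cases hj : 0 ≤ j
  swap
  · rw [cc_neg _ _ _ (by omega), cc_neg _ _ _ (by omega)]
  by_cases hi : 0 ≤ i
  swap
  · rw [cc_neg _ _ _ (by omega), cc_neg _ _ _ (by omega)]
  lift i to ℕ using hi
  lift j to ℕ using hj
  rw [cc_nat, coeff_X_mul']
  cases j with
  | zero => rw [cc_neg _ _ _ (by simp)]; simp [expo]
  | succ j =>
    rw [show ((j + 1 : ℕ) : ℤ) - 1 = (j : ℤ) by push_cast; ring, cc_nat, if_pos]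
    · congr 1
      ext l; fin_cases l <;> simp [expo]
    · simp [expo]

theorem cc_X0_pow (n : ℕ) (p : MvPolynomial (Fin 2) k) (i j : ℤ) :
    cc (X 0 ^ n * p) i j = cc p (i - n) j := by
  induction n generalizing i with
  | zero => simp
  | succ n ih => rw [pow_succ', mul_assoc, cc_X0, ih]; congr 1; push_cast; ring

theorem cc_X1_pow (n : ℕ) (p : MvPolynomial (Fin 2) k) (i j : ℤ) :
    cc (X 1 ^ n * p) i j = cc p i (j - n) := by
  induction n generalizing j with
  | zero => simp
  | succ n ih => rw [pow_succ', mul_assoc, cc_X1, ih]; congr 1; push_cast; ring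

theorem cc_pderiv0 (p : MvPolynomial (Fin 2) k) (i j : ℤ) :
    cc (pderiv 0 p) i j = ((i : k) + 1) * cc p (i + 1) j := by
  by_cases hj : 0 ≤ j
  swap
  · rw [cc_neg _ _ _ (by omega), cc_neg _ _ _ (by omega), mul_zero]
  by_cases hi : 0 ≤ i
  swap
  · rw [cc_neg _ _ _ (by omega)]
    by_cases h : i = -1
    · simp [h]
    · rw [cc_neg _ _ _ (by omega), mul_zero]
  lift i to ℕ using hi
  lift j to ℕ using hj
  rw [show (i : ℤ) + 1 = ((i + 1 : ℕ) : ℤ) by push_cast; ring, cc_nat, cc_nat, coeff_pderiv, expo_zero]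
  rw [show expo i j + Finsupp.single 0 1 = expo (i + 1) j by
    ext l; fin_cases l <;> simp [expo]]
  push_cast; ring

theorem cc_pderiv1 (p : MvPolynomial (Fin 2) k) (i j : ℤ) :
    cc (pderiv 1 p) i j = ((j : k) + 1) * cc p i (j + 1) := by
  by_cases hi : 0 ≤ i
  swap
  · rw [cc_neg _ _ _ (by omega), cc_neg _ _ _ (by omega), mul_zero]
  by_cases hj : 0 ≤ j
  swap
  · rw [cc_neg _ _ _ (by omega)]
    by_cases h : j = -1
    · simp [h]
    · rw [cc_neg _ _ _ (by omega), mul_zero]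
  lift i to ℕ using hi
  lift j to ℕ using hj
  rw [show (j : ℤ) + 1 = ((j + 1 : ℕ) : ℤ) by push_cast; ring, cc_nat, cc_nat, coeff_pderiv, expo_one]
  rw [show expo i j + Finsupp.single 1 1 = expo i (j + 1) by
    ext l; fin_cases l <;> simp [expo]]
  push_cast; ring

/-- The derivation of the statement. -/
noncomputable abbrev dd (k : Type*) [Field k] (s t u : ℕ) :
    Derivation k (MvPolynomial (Fin 2) k) (MvPolynomial (Fin 2) k) :=
  MvPolynomial.mkDerivation k ![1, X 0 ^ u * (X 0 ^ t + X 1 ^ s)]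

theorem dd_X0 (s t u : ℕ) : dd k s t u (X 0) = 1 := by
  rw [mkDerivation_X]; rfl
theorem dd_X1 (s t u : ℕ) : dd k s t u (X 1) = X 0 ^ u * (X 0 ^ t + X 1 ^ s) := by
  rw [mkDerivation_X]; rfl

theorem dd_apply (s t u : ℕ) (p : MvPolynomial (Fin 2) k) :
    dd k s t u p = pderiv 0 p + X 0 ^ u * (X 0 ^ t * pderiv 1 p) + X 0 ^ u * (X 1 ^ s * pderiv 1 p) := by
  have : dd k s t u = pderiv 0 + (X 0 ^ u * (X 0 ^ t + X 1 ^ s) : MvPolynomial (Fin 2) k) • pderiv 1 := by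
    apply derivation_ext
    intro i
    fin_cases i
    · change dd k s t u (X 0) = _
      rw [dd_X0]; simp
    · change dd k s t u (X 1) = _
      rw [dd_X1]; simp
  rw [this]
  simp only [Derivation.add_apply, Derivation.smul_apply, smul_eq_mul]
  ring

theorem cc_dd (s t u : ℕ) (p : MvPolynomial (Fin 2) k) (I J : ℤ) :
    cc (dd k s t u p) I J = ((I : k) + 1) * cc p (I + 1) J
      + ((J : k) + 1) * cc p (I - u - t) (J + 1)
      + ((J : k) - s + 1) * cc p (I - u) (J - s + 1) := by
  rw [dd_apply, cc_add, cc_add, cc_pderiv0, cc_X0_pow, cc_X0_pow, cc_X0_pow, cc_X1_pow,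
    cc_pderiv1, cc_pderiv1]
  push_cast
  ring

theorem cc_high (p : MvPolynomial (Fin 2) k) (i j : ℤ)
    (h : (degreeOf 0 p : ℤ) < i ∨ (degreeOf 1 p : ℤ) < j) : cc p i j = 0 := by
  by_contra hne
  have hij : 0 ≤ i ∧ 0 ≤ j := by
    by_contra h'
    exact hne (cc_neg _ _ _ (by omega))
  obtain ⟨hi, hj⟩ := hij
  lift i to ℕ using hi
  lift j to ℕ using hj
  rw [cc_nat] at hne
  have h0 := monomial_le_degreeOf 0 (mem_support_iff.mpr hne)
  have h1 := monomial_le_degreeOf 1 (mem_support_iff.mpr hne)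
  rw [expo_zero] at h0
  rw [expo_one] at h1
  omega

theorem no_darboux_special [CharZero k] (s t u : ℕ) (hs : 2 ≤ s) (ht : 1 ≤ t) (a : k)
    (F : MvPolynomial (Fin 2) k) (hF0 : F ≠ 0) (hF : ¬ IsUnit F)
    (h : dd k s t u F = C a * X 0 ^ u * X 1 ^ (s - 1) * F) : False := by
  have H : ∀ I J : ℤ, ((I : k) + 1) * cc F (I + 1) J + ((J : k) + 1) * cc F (I - u - t) (J + 1)
      + ((J : k) - s + 1) * cc F (I - u) (J - s + 1) = a * cc F (I - u) (J - s + 1) := by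
    intro I J
    have h' := congrArg (fun p => cc p I J) h
    simp only [cc_dd] at h'
    rw [h', mul_assoc, mul_assoc, cc_C_mul, cc_X0_pow, cc_X1_pow]
    congr 2
    push_cast [Nat.cast_sub (by omega : 1 ≤ s)]
    ring
  by_cases hn : degreeOf 0 F = 0
  · -- then `F` is a polynomial in `y` killed by the `x ^ (u+t)` part
    have hz : ∀ i j : ℕ, ¬ (i = 0 ∧ j = 0) → coeff (expo i j) F = 0 := by
      intro i j hij
      rw [← cc_nat]
      by_cases hi : i = 0
      · subst hi
        have h' := H (u + t) (j - 1)
        rw [cc_high F (u + t + 1) _ (by left; rw [hn]; push_cast; omega),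
          cc_high F (u + t - u) _ (by left; rw [hn]; push_cast; omega),
          show (u + t - u - t : ℤ) = ((0 : ℕ) : ℤ) by push_cast; ring, show (j - 1 + 1 : ℤ) = j by ring] at h'
        push_cast at h'
        simp only [mul_zero, zero_add, add_zero, sub_add_cancel] at h'
        have : (j : k) ≠ 0 := by
          have : j ≠ 0 := by tauto
          exact_mod_cast this
        push_cast
        simpa [this] using h'
      · exact cc_high F _ _ (by left; rw [hn]; omega)
    have hFC : F = C (coeff 0 F) := by
      ext m
      rw [coeff_C]
      split_ifs with hm
      · rw [hm]
      · rw [← expo_eta m]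
        apply hz
        rintro ⟨h0, h1⟩
        apply hm
        rw [← expo_eta m, h0, h1]
        simp [expo]
    apply hF
    rw [hFC]
    apply IsUnit.map
    rw [isUnit_iff_ne_zero]
    intro h0
    rw [h0, map_zero] at hFC
    exact hF0 hFC
  · refine comb_contra s t u (degreeOf 0 F) (by exact_mod_cast hs) (by exact_mod_cast ht) (by positivity)
      (by omega) a (cc F) (fun i j h => cc_neg _ _ _ (Or.inl h)) (fun i j h => cc_neg _ _ _ (Or.inr h))
      (by exact_mod_cast H) (fun i j h => cc_high _ _ _ (Or.inl h)) ?_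
    obtain ⟨m, hm, hm'⟩ := Finset.exists_mem_eq_sup F.support (support_nonempty.mpr hF0) (fun m => m 0)
    rw [← degreeOf_eq_sup] at hm'
    refine ⟨m 1, ?_⟩
    rw [hm', cc_nat, expo_eta]
    exact mem_support_iff.mp hm
end

open scoped Polynomial

section
variable {k : Type*} [Field k]

theorem psi_coeff (ω : k) (w : ℕ) (ψ : MvPolynomial (Fin 2) k →ₐ[k] MvPolynomial (Fin 2) k)
    (hx : ψ (X 0) = C ω * X 0) (hy : ψ (X 1) = C (ω ^ w) * X 1)
    (p : MvPolynomial (Fin 2) k) (m : Fin 2 →₀ ℕ) :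
    coeff m (ψ p) = ω ^ (m 0 + w * m 1) * coeff m p := by
  classical
  induction p using MvPolynomial.induction_on' with
  | add p q hp hq => rw [map_add, coeff_add, hp, hq, coeff_add]; ring
  | monomial n a =>
    have : ψ (monomial n a) = monomial n (ω ^ (n 0 + w * n 1) * a) := by
      rw [monomial_eq, monomial_eq, Finsupp.prod_fintype _ _ (by simp), Fin.prod_univ_two, map_mul,
        map_mul, map_pow, map_pow, hx, hy, mul_pow, mul_pow, ← algebraMap_eq, AlgHom.commutes]
      simp only [algebraMap_eq, map_mul, map_pow]
      ring
    rw [this, coeff_monomial, coeff_monomial]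
    split_ifs with h
    · rw [h]
    · simp

theorem dd_psi (s t u : ℕ) (ω : k) (hω : ω ^ ((s - 1) * t + (u + 1) * s) = 1) (hs : 2 ≤ s)
    (ψ : MvPolynomial (Fin 2) k →ₐ[k] MvPolynomial (Fin 2) k)
    (hx : ψ (X 0) = C ω * X 0) (hy : ψ (X 1) = C (ω ^ (u + t + 1)) * X 1)
    (p : MvPolynomial (Fin 2) k) :
    dd k s t u (ψ p) = C ω * ψ (dd k s t u p) := by
  have hX : ∀ i, dd k s t u (ψ (X i)) = C ω * ψ (dd k s t u (X i)) := by
    intro i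
    fin_cases i
    · change dd k s t u (ψ (X 0)) = C ω * ψ (dd k s t u (X 0))
      rw [hx, C_mul', Derivation.map_smul, dd_X0, map_one, smul_eq_C_mul]
    · change dd k s t u (ψ (X 1)) = C ω * ψ (dd k s t u (X 1))
      rw [hy, C_mul', Derivation.map_smul, dd_X1, smul_eq_C_mul]
      simp only [map_mul, map_pow, map_add, hx, hy, mul_pow]
      have h2 : (C ω : MvPolynomial (Fin 2) k) ^ (1 + u + (u + t + 1) * s) = C ω ^ (u + t + 1) := by
        rw [← map_pow, ← map_pow]
        congr 1
        obtain ⟨r, rfl⟩ : ∃ r, s = r + 1 := ⟨s - 1, by omega⟩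
        rw [Nat.add_sub_cancel] at hω
        rw [show 1 + u + (u + t + 1) * (r + 1) = (u + t + 1) + (r * t + (u + 1) * (r + 1)) by ring,
          pow_add, hω, mul_one]
      linear_combination (-(X 0 ^ u * X 1 ^ s)) * h2
  induction p using MvPolynomial.induction_on with
  | C a => 
    rw [← algebraMap_eq, AlgHom.commutes]
    simp
  | add p q hp hq => simp only [map_add, hp, hq]; ring
  | mul_X p i hp =>
    rw [map_mul, Derivation.leibniz, Derivation.leibniz, hp, hX]
    simp only [smul_eq_mul, map_add, map_mul]
    ring

theorem dd_prod (d : Derivation k (MvPolynomial (Fin 2) k) (MvPolynomial (Fin 2) k))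
    (F L : ℕ → MvPolynomial (Fin 2) k) (h : ∀ i, d (F i) = L i * F i) (N : ℕ) :
    d (∏ i ∈ Finset.range N, F i) = (∑ i ∈ Finset.range N, L i) * ∏ i ∈ Finset.range N, F i := by
  induction N with
  | zero => simp
  | succ N ih =>
    rw [Finset.prod_range_succ, Finset.sum_range_succ, Derivation.leibniz, ih, h]
    simp only [smul_eq_mul]
    ring

theorem arith_aux (s t u i j : ℕ) (hs : 2 ≤ s) (hi : i ≤ u + t) (hj : j ≤ s - 1)
    (h : (s - 1) * t + (u + 1) * s ∣ 1 + (i + (u + t + 1) * j)) : i = u ∧ j = s - 1 := by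
  obtain ⟨r, rfl⟩ : ∃ r, s = r + 1 := ⟨s - 1, by omega⟩
  rw [Nat.add_sub_cancel] at *
  obtain ⟨c, hc⟩ := h
  have hr : 1 ≤ r := by omega
  have hb : (u + t + 1) * j ≤ (u + t + 1) * r := Nat.mul_le_mul_left _ hj
  have htr : t ≤ r * t := Nat.le_mul_of_pos_left t hr
  have e1 : r * t + (u + 1) * (r + 1) = (u + t + 1) * r + (u + 1) := by ring
  have hc1 : c = 1 := by
    have h0 : c ≠ 0 := by rintro rfl; omega
    have h2 : c < 2 := by
      by_contra h2
      have : (r * t + (u + 1) * (r + 1)) * 2 ≤ (r * t + (u + 1) * (r + 1)) * c :=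
        Nat.mul_le_mul_left _ (by omega)
      have : 0 < (u + 1) * (r + 1) := by positivity
      nlinarith
    omega
  rw [hc1, mul_one, e1] at hc
  have hjr : j = r := by
    by_contra hne
    have : j + 1 ≤ r := by omega
    have := Nat.mul_le_mul_left (u + t + 1) this
    nlinarith
  subst hjr
  exact ⟨by omega, rfl⟩

theorem degree_bounds (s t u : ℕ) (hs : 2 ≤ s) (F L : MvPolynomial (Fin 2) k) (hF : F ≠ 0)
    (hL : L ≠ 0) (h : dd k s t u F = L * F) : degreeOf 0 L ≤ u + t ∧ degreeOf 1 L ≤ s - 1 := by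
  have key : ∀ m ∈ (L * F).support, m 0 ≤ degreeOf 0 F + (u + t) ∧ m 1 ≤ degreeOf 1 F + (s - 1) := by
    intro m hm
    by_contra hcon
    apply mem_support_iff.mp hm
    rw [← h, ← expo_eta m, ← cc_nat, cc_dd, cc_high, cc_high, cc_high]
    · simp
    all_goals omega
  have h0 := degreeOf_mul_eq (n := 0) hL hF
  have h1 := degreeOf_mul_eq (n := 1) hL hF
  have h2 := degreeOf_le_iff.mpr fun m hm => (key m hm).1
  have h3 := degreeOf_le_iff.mpr fun m hm => (key m hm).2
  omega

theorem no_darboux [CharZero k] (s t u : ℕ) (hs : 2 ≤ s) (ht : 1 ≤ t) (ω : k)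
    (hω : IsPrimitiveRoot ω ((s - 1) * t + (u + 1) * s))
    (ψ : MvPolynomial (Fin 2) k ≃ₐ[k] MvPolynomial (Fin 2) k)
    (hx : ψ (X 0) = C ω * X 0) (hy : ψ (X 1) = C (ω ^ (u + t + 1)) * X 1)
    (F L : MvPolynomial (Fin 2) k) (hF0 : F ≠ 0) (hFu : ¬ IsUnit F)
    (h : dd k s t u F = L * F) : False := by
  set v := (s - 1) * t + (u + 1) * s with hv
  have hvpos : 0 < v := by
    have : 0 < (u + 1) * s := by positivity
    omega
  let Fi : ℕ → MvPolynomial (Fin 2) k := fun i => ψ^[i] F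
  let Li : ℕ → MvPolynomial (Fin 2) k := fun i => (fun q => C ω * ψ q)^[i] L
  have hFi : ∀ i, Fi (i + 1) = ψ (Fi i) := fun i => Function.iterate_succ_apply' _ _ _
  have hLi : ∀ i, Li (i + 1) = C ω * ψ (Li i) := fun i => Function.iterate_succ_apply' _ _ _
  have hFL : ∀ i, dd k s t u (Fi i) = Li i * Fi i := by
    intro i
    induction i with
    | zero => exact h
    | succ i ih =>
      rw [hFi, hLi]
      have := dd_psi s t u ω hω.pow_eq_one hs ψ.toAlgHom hx hy (Fi i)
      change dd k s t u (ψ (Fi i)) = C ω * ψ (dd k s t u (Fi i)) at this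
      rw [this, ih, map_mul]
      ring
  have hFi0 : ∀ i, Fi i ≠ 0 := by
    intro i
    induction i with
    | zero => exact hF0
    | succ i ih => rw [hFi]; simpa using ih
  have hLc : ∀ i m, coeff m (Li i) = (ω ^ (1 + (m 0 + (u + t + 1) * m 1))) ^ i * coeff m L := by
    intro i m
    induction i with
    | zero => simp [Li]
    | succ i ih =>
      have := psi_coeff ω (u + t + 1) ψ.toAlgHom hx hy (Li i) m
      change coeff m (ψ (Li i)) = _ at this
      rw [hLi, coeff_C_mul, this, ih]
      ring
  set G := ∏ i ∈ Finset.range v, Fi i with hG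
  set M := ∑ i ∈ Finset.range v, Li i with hM
  have hGM : dd k s t u G = M * G := dd_prod _ Fi Li hFL v
  have hG0 : G ≠ 0 := Finset.prod_ne_zero_iff.mpr fun i _ => hFi0 i
  have hGu : ¬ IsUnit G := by
    intro hu
    apply hFu
    have : Fi 0 ∣ G := Finset.dvd_prod_of_mem _ (Finset.mem_range.mpr hvpos)
    exact isUnit_of_dvd_unit this hu
  have hMc : ∀ m : Fin 2 →₀ ℕ, ¬ v ∣ 1 + (m 0 + (u + t + 1) * m 1) → coeff m M = 0 := by
    intro m hm
    rw [hM, coeff_sum]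
    simp_rw [hLc]
    rw [← Finset.sum_mul]
    set ζ := ω ^ (1 + (m 0 + (u + t + 1) * m 1))
    have h1 : ζ ≠ 1 := fun h => hm ((hω.pow_eq_one_iff_dvd _).mp h)
    have h2 : ζ ^ v = 1 := by
      rw [← pow_mul, mul_comm, pow_mul, hω.pow_eq_one, one_pow]
    have h3 := mul_geom_sum ζ v
    rw [h2, sub_self] at h3
    rw [(mul_eq_zero.mp h3).resolve_left (sub_ne_zero.mpr h1), zero_mul]
  have hMform : M = C (coeff (expo u (s - 1)) M) * X 0 ^ u * X 1 ^ (s - 1) := by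
    by_cases hM0 : M = 0
    · rw [hM0]; simp
    obtain ⟨b0, b1⟩ := degree_bounds s t u hs G M hG0 hM0 hGM
    have : C (coeff (expo u (s - 1)) M) * X 0 ^ u * X 1 ^ (s - 1)
        = monomial (expo u (s - 1)) (coeff (expo u (s - 1)) M) := by
      rw [monomial_eq, Finsupp.prod_fintype _ _ (by simp), Fin.prod_univ_two, expo_zero, expo_one,
        mul_assoc]
    rw [this]
    classical
    ext m
    rw [coeff_monomial]
    split_ifs with hm
    · rw [hm]
    · by_contra hne
      have c0 := (monomial_le_degreeOf 0 (mem_support_iff.mpr hne)).trans b0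
      have c1 := (monomial_le_degreeOf 1 (mem_support_iff.mpr hne)).trans b1
      by_cases hd : v ∣ 1 + (m 0 + (u + t + 1) * m 1)
      · obtain ⟨e0, e1⟩ := arith_aux s t u _ _ hs c0 c1 hd
        apply hm
        rw [← expo_eta m, e0, e1]
      · exact hne (hMc m hd)
  exact no_darboux_special s t u hs ht _ G hG0 hGu (by rw [hGM, ← hMform])
end

section ideal
namespace Polynomial
theorem exists_darboux_poly {k : Type*} [Field k] [CharZero k] 
    (δ : k[X][X] → k[X][X]) (hC : ∀ q : k[X], δ (C q) = C (derivative q))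
    (hmul : ∀ p q, δ (p * q) = p * δ q + q * δ p)
    (I : Ideal k[X][X]) (hbot : I ≠ ⊥) (htop : I ≠ ⊤) (hI : ∀ f ∈ I, δ f ∈ I) :
    ∃ P : k[X][X], P ≠ 0 ∧ ¬ IsUnit P ∧ P ∣ δ P := by
  classical
  -- no constants in `I`
  have hconst : ∀ (n : ℕ) (q : k[X]), q.natDegree ≤ n → q ≠ 0 → C q ∉ I := by
    intro n
    induction n with
    | zero =>
      intro q hq hq0 hmem
      apply htop
      apply Ideal.eq_top_of_isUnit_mem _ hmem
      rw [Polynomial.isUnit_C, Polynomial.isUnit_iff_degree_eq_zero, degree_eq_natDegree hq0,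
        Nat.le_zero.mp hq]
      rfl
    | succ n ih =>
      intro q hq hq0 hmem
      by_cases hd : derivative q = 0
      · have := derivative_eq_zero.mp hd
        exact ih q (by omega) hq0 hmem
      · refine ih _ ?_ hd (by rw [← hC]; exact hI _ hmem)
        have := natDegree_derivative_le q
        omega
  have hex : ∃ n : ℕ, ∃ f ∈ I, f ≠ 0 ∧ f.natDegree = n := by
    obtain ⟨f, hf, hf0⟩ := Submodule.exists_mem_ne_zero_of_ne_bot hbot
    exact ⟨_, f, hf, hf0, rfl⟩
  obtain ⟨f, hfI, hf0, hfn⟩ := Nat.find_spec hex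
  have hmin : ∀ g ∈ I, g.natDegree < f.natDegree → g = 0 := by
    intro g hg hlt
    by_contra hg0
    exact Nat.find_min hex (by rwa [hfn] at hlt) ⟨g, hg, hg0, rfl⟩
  have hfpos : 0 < f.natDegree := by
    by_contra hcon
    rw [Polynomial.eq_C_of_natDegree_eq_zero (by omega : f.natDegree = 0)] at hfI hf0
    exact hconst _ _ le_rfl (by simpa using hf0) hfI
  have hlf : f.leadingCoeff ≠ 0 := leadingCoeff_ne_zero.mpr hf0
  -- pseudo-division
  have hdiv : ∀ (n : ℕ) (g : k[X][X]), g ∈ I → g.natDegree ≤ n → ∃ c : k[X], c ≠ 0 ∧ f ∣ C c * g := by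
    intro n
    induction n with
    | zero =>
      intro g hg hgn
      refine ⟨1, one_ne_zero, ?_⟩
      rw [hmin g hg (by omega)]
      simp
    | succ n ih =>
      intro g hg hgn
      by_cases hlt : g.natDegree < f.natDegree
      · refine ⟨1, one_ne_zero, ?_⟩
        rw [hmin g hg hlt]
        simp
      · have hfg : f.natDegree ≤ g.natDegree := by omega
        set r := C f.leadingCoeff * g - C g.leadingCoeff * X ^ (g.natDegree - f.natDegree) * f with hr
        have hrI : r ∈ I := I.sub_mem (I.mul_mem_left _ hg) (I.mul_mem_left _ hfI)
        have hrn : r.natDegree ≤ n := by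
          rw [natDegree_le_iff_coeff_eq_zero]
          intro N hN
          rw [hr, coeff_sub, coeff_C_mul, mul_assoc, coeff_C_mul, coeff_X_pow_mul', if_pos (by omega)]
          by_cases hNg : N = g.natDegree
          · rw [hNg, Nat.sub_sub_self hfg, coeff_natDegree, coeff_natDegree]
            ring
          · rw [coeff_eq_zero_of_natDegree_lt (by omega : g.natDegree < N),
              coeff_eq_zero_of_natDegree_lt (by omega : f.natDegree < _)]
            simp
        obtain ⟨c, hc, q, hq⟩ := ih r hrI hrn
        refine ⟨c * f.leadingCoeff, mul_ne_zero hc hlf,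
          q + C c * (C g.leadingCoeff * X ^ (g.natDegree - f.natDegree)), ?_⟩
        rw [mul_add, ← hq, hr, C_mul]
        ring
  obtain ⟨c, hc, hcd⟩ := hdiv _ (δ f) (hI f hfI) le_rfl
  let _ : NormalizedGCDMonoid k[X] := UniqueFactorizationMonoid.toNormalizedGCDMonoid _
  have hP := isPrimitive_primPart f
  have hPn := natDegree_primPart f
  have hfP := eq_C_content_mul_primPart f
  have hcont : f.content ≠ 0 := by rwa [Ne, content_eq_zero_iff]
  set P := f.primPart
  set a := f.content
  refine ⟨P, hP.ne_zero, ?_, ?_⟩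
  · intro hu
    have := natDegree_eq_zero_of_isUnit hu
    omega
  have hPd : P ∣ C (c * a) * δ P := by
    have h1 : P ∣ C c * δ f := (primPart_dvd f).trans hcd
    rw [hfP, hmul, hC, mul_add] at h1
    have h2 : P ∣ C c * (P * C (derivative a)) := ⟨C c * C (derivative a), by ring⟩
    have h3 := (dvd_add_left h2).mp h1
    rwa [← mul_assoc, ← C_mul] at h3
  have hrel : IsRelPrime P (C (c * a)) := by
    intro z hz1 hz2
    have hne : (C (c * a) : k[X][X]) ≠ 0 := C_ne_zero.mpr (mul_ne_zero hc hcont)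
    have hzd : z.natDegree = 0 := by
      have := natDegree_le_of_dvd hz2 hne
      rw [natDegree_C] at this
      omega
    rw [eq_C_of_natDegree_eq_zero hzd] at hz1 ⊢
    exact (hP _ hz1).map C
  exact hrel.dvd_of_dvd_mul_left hPd

end Polynomial

theorem exists_darboux {k : Type*} [Field k] [CharZero k]
    (d : Derivation k (MvPolynomial (Fin 2) k) (MvPolynomial (Fin 2) k)) (hd : d (X 0) = 1)
    (I : Ideal (MvPolynomial (Fin 2) k)) (hbot : I ≠ ⊥) (htop : I ≠ ⊤) (hI : ∀ f ∈ I, d f ∈ I) :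
    ∃ F : MvPolynomial (Fin 2) k, F ≠ 0 ∧ ¬ IsUnit F ∧ F ∣ d F := by
  let e := Polynomial.Bivariate.equivMvPolynomial k
  have key := Polynomial.exists_darboux_poly (fun p => e.symm (d (e p))) (?_) (?_)
    (I.comap (e : _ →+* MvPolynomial (Fin 2) k)) (?_) (?_) (?_)
  · obtain ⟨P, hP0, hPu, hPd⟩ := key
    refine ⟨e P, by simpa using hP0, ?_, ?_⟩
    · intro hu
      apply hPu
      simpa using hu.map e.symm
    · have := map_dvd e hPd
      simpa using this
  · intro q
    rw [AlgEquiv.symm_apply_eq]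
    induction q using Polynomial.induction_on' with
    | add p q hp hq => simp only [map_add, hp, hq]
    | monomial n a =>
      rw [← Polynomial.C_mul_X_pow_eq_monomial]
      simp only [map_mul, map_pow, Polynomial.derivative_C_mul, Polynomial.derivative_X_pow]
      simp only [e, Polynomial.Bivariate.equivMvPolynomial_C_C,
        Polynomial.Bivariate.equivMvPolynomial_C_X, Derivation.leibniz, derivation_C, Derivation.leibniz_pow, hd]
      simp
  · intro p q
    simp [Derivation.leibniz]
  · intro h
    apply hbot
    rw [eq_bot_iff]
    intro x hx
    have : e.symm x ∈ I.comap (e : _ →+* MvPolynomial (Fin 2) k) := by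
      simpa [Ideal.mem_comap] using hx
    rw [h] at this
    simpa using this
  · intro h
    apply htop
    rw [Ideal.eq_top_iff_one] at h ⊢
    simpa [Ideal.mem_comap] using h
  · intro f hf
    rw [Ideal.mem_comap] at hf ⊢
    simpa using hI _ hf
end ideal

theorem darboux_element_structure_xt_ys
    (k : Type*) [Field k] [CharZero k] [IsAlgClosed k]
    (s t u : ℕ) (hs : 2 ≤ s) (ht : 1 ≤ t)
    (v : ℕ) (hv : v = (s - 1) * t + (u + 1) * s)
    (ω : k) (hω : IsPrimitiveRoot ω v)
    (ψ : MvPolynomial (Fin 2) k ≃ₐ[k] MvPolynomial (Fin 2) k)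
    (hψx : ψ (X 0) = C ω * X 0) (hψy : ψ (X 1) = C (ω ^ (u + t + 1)) * X 1)
    (hns : ¬ IsSimpleDerivation
      (MvPolynomial.mkDerivation k ![1, X 0 ^ u * (X 0 ^ t + X 1 ^ s)])) :
    ∃ (n : ℕ) (a : k) (ac : ℕ → MvPolynomial (Fin 2) k),
      0 < n ∧ t ∣ n ∧ v ∣ n ∧
      (∀ i, ac i ∈ Algebra.adjoin k {(X 1 : MvPolynomial (Fin 2) k)}) ∧
      ac n = 1 ∧
      (∀ i, 1 ≤ i → i ≤ t - 1 → ac (n - t + i) = 0) ∧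
      ∃ g : MvPolynomial (Fin 2) k,
        g = ∑ i ∈ Finset.range (n + 1), ac i * X 0 ^ i ∧
        (MvPolynomial.mkDerivation k
            (![1, X 0 ^ u * (X 0 ^ t + X 1 ^ s)] : Fin 2 → MvPolynomial (Fin 2) k)) g =
          C a * X 0 ^ u * X 1 ^ (s - 1) * g ∧
        ψ g = g := by
  exfalso
  apply hns
  intro I hI
  by_contra hcon
  push Not at hcon
  obtain ⟨F, hF0, hFu, L, hL⟩ := exists_darboux (dd k s t u) (dd_X0 s t u) I hcon.1 hcon.2 hI
  subst hv
  exact no_darboux s t u hs ht ω hω ψ hψx hψy F L hF0 hFu (by rw [hL, mul_comm])
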